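/- Let p, q : [0,1) → ℝ be integrable, ξ ∈ [0,1), η ∈ ℝ, n ∈ ℕ, n ≥ 1, and let k* ∈ {1,…,2^n} be the index with ξ ∈ I_n(k*). Write p̃_n = S_{2^n}p and q̃_n = S_{2^n}q. If ȳ_n is a Walsh polynomial of degree < 2^n satisfying ȳ_n(x) = η + S_{2^n}( ∫_ξ^{·} (q̃_n(t) − p̃_n(t) ȳ_n(t)) dt )(x) for all x ∈ [0,1), then ȳ_n((k*−1)/2^n) · (1 + p̃_n((k*−1)/2^n)·((2k*−1)/2^{n+1} − ξ)) = η + q̃_n((k*−1)/2^n)·((2k*−1)/2^{n+1} − ξ). -/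

import Mathlib

open MeasureTheory Matrix

/-- The `k`-th binary digit of `x ∈ [0,1)`, using the expansion terminating in zeros
for dyadic rationals. -/
noncomputable def binDigit (k : ℕ) (x : ℝ) : ℕ := ⌊x * 2 ^ (k + 1)⌋.toNat % 2

/-- Rademacher functions `r_k(x) = (-1)^{x_k}`. -/
noncomputable def rademacher (k : ℕ) (x : ℝ) : ℝ := (-1 : ℝ) ^ binDigit k x

/-- Walsh–Paley functions `ω_n(x) = ∏_k r_k(x)^{n_k}`. -/
noncomputable def walsh (n : ℕ) (x : ℝ) : ℝ :=
  ∏ k ∈ Finset.range n, if n.testBit k then rademacher k x else 1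

/-- Walsh–Fourier coefficient `f̂_k = ∫₀¹ f ω_k`. -/
noncomputable def fcoef (f : ℝ → ℝ) (k : ℕ) : ℝ := ∫ x in (0:ℝ)..1, f x * walsh k x

/-- The `2^n`-th partial sum of the Walsh–Fourier series:
`S_{2^n} f (x) = ∑_{k<2^n} f̂_k ω_k(x)`. -/
noncomputable def S2 (n : ℕ) (f : ℝ → ℝ) (x : ℝ) : ℝ :=
  ∑ k ∈ Finset.range (2 ^ n), fcoef f k * walsh k x


theorem binDigit_eq_floor_mod (k : ℕ) (x : ℝ) :
    binDigit k x = ⌊x * 2 ^ (k + 1)⌋₊ % 2 := by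
  rw [binDigit, Int.floor_toNat]

theorem floor_mul_two_pow_succ_div_two (n : ℕ) (x : ℝ) :
    ⌊x * 2 ^ (n + 1)⌋₊ / 2 = ⌊x * 2 ^ n⌋₊ := by
  rw [← Nat.floor_div_natCast]
  congr 1
  push_cast
  ring

theorem floor_mul_two_pow_succ_eq_iff (n : ℕ) (x t : ℝ) :
    ⌊x * 2 ^ (n + 1)⌋₊ = ⌊t * 2 ^ (n + 1)⌋₊ ↔
      ⌊x * 2 ^ n⌋₊ = ⌊t * 2 ^ n⌋₊ ∧ binDigit n x = binDigit n t := by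
  rw [binDigit_eq_floor_mod, binDigit_eq_floor_mod, ← floor_mul_two_pow_succ_div_two n x,
    ← floor_mul_two_pow_succ_div_two n t]
  omega

theorem rademacher_eq_or (k : ℕ) (x : ℝ) : rademacher k x = 1 ∨ rademacher k x = -1 :=
  neg_one_pow_eq_or ℝ _

theorem one_add_rademacher_mul (k : ℕ) (x t : ℝ) :
    1 + rademacher k x * rademacher k t = if binDigit k x = binDigit k t then 2 else 0 := by
  have hx : binDigit k x < 2 := Nat.mod_lt _ two_pos
  have ht : binDigit k t < 2 := Nat.mod_lt _ two_pos
  unfold rademacher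
  generalize binDigit k x = a at *
  generalize binDigit k t = b at *
  interval_cases a <;> interval_cases b <;> norm_num

theorem walsh_eq_prod_range {m N : ℕ} (h : m < 2 ^ N) (x : ℝ) :
    walsh m x = ∏ k ∈ Finset.range N, if m.testBit k then rademacher k x else 1 := by
  have key : ∀ a b : ℕ, a ≤ b → m < 2 ^ a →
      (∏ k ∈ Finset.range a, if m.testBit k then rademacher k x else 1) =
        ∏ k ∈ Finset.range b, if m.testBit k then rademacher k x else 1 := by
    intro a b hab hm
    refine Finset.prod_subset (Finset.range_mono hab) fun k _ hk => ?_
    have hak : a ≤ k := by simpa using hk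
    have : m < 2 ^ k := hm.trans_le (Nat.pow_le_pow_right two_pos hak)
    simp [Nat.testBit_lt_two_pow this]
  rcases le_total m N with hmN | hmN
  · exact key m N hmN Nat.lt_two_pow_self
  · exact (key N m hmN h).symm

theorem walsh_two_pow_add {n m : ℕ} (h : m < 2 ^ n) (x : ℝ) :
    walsh (2 ^ n + m) x = rademacher n x * walsh m x := by
  rw [walsh_eq_prod_range (N := n + 1) (by rw [pow_succ]; omega), walsh_eq_prod_range h,
    Finset.prod_range_succ, mul_comm]
  congr 1
  · simp [Nat.testBit_two_pow_add_eq, Nat.testBit_lt_two_pow h]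
  · refine Finset.prod_congr rfl fun k hk => ?_
    rw [Nat.testBit_two_pow_add_gt (Finset.mem_range.1 hk)]

/-- The Walsh–Dirichlet kernel of order `2 ^ n` is `2 ^ n` times the indicator that both points
lie in the same dyadic interval of length `2 ^ (-n)`. -/
theorem sum_walsh_mul_walsh (n : ℕ) {x t : ℝ} (hx : x < 1) (ht : t < 1) :
    ∑ k ∈ Finset.range (2 ^ n), walsh k x * walsh k t =
      if ⌊x * 2 ^ n⌋₊ = ⌊t * 2 ^ n⌋₊ then (2 : ℝ) ^ n else 0 := by
  induction n with
  | zero => simp [walsh, Nat.floor_eq_zero.2 hx, Nat.floor_eq_zero.2 ht]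
  | succ n ih =>
    have hstep : ∑ k ∈ Finset.range (2 ^ (n + 1)), walsh k x * walsh k t =
        (∑ k ∈ Finset.range (2 ^ n), walsh k x * walsh k t) *
          (1 + rademacher n x * rademacher n t) := by
      rw [pow_succ, mul_two, Finset.sum_range_add, mul_add, mul_one, Finset.sum_mul]
      congr 1
      refine Finset.sum_congr rfl fun k hk => ?_
      rw [walsh_two_pow_add (Finset.mem_range.1 hk), walsh_two_pow_add (Finset.mem_range.1 hk)]
      ring
    rw [hstep, ih, one_add_rademacher_mul, ite_mul, zero_mul, mul_ite, mul_zero, ← pow_succ,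
      ← ite_and]
    simp only [floor_mul_two_pow_succ_eq_iff]

theorem walsh_congr {n k : ℕ} (hk : k < 2 ^ n) {x t : ℝ}
    (h : ⌊x * 2 ^ n⌋₊ = ⌊t * 2 ^ n⌋₊) : walsh k x = walsh k t := by
  have hdigit : ∀ (n : ℕ), ⌊x * 2 ^ n⌋₊ = ⌊t * 2 ^ n⌋₊ →
      ∀ j < n, binDigit j x = binDigit j t := by
    intro n
    induction n with
    | zero => simp
    | succ n ih =>
      intro h j hj
      obtain ⟨h1, h2⟩ := (floor_mul_two_pow_succ_eq_iff n x t).1 h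
      rcases Nat.lt_succ_iff_lt_or_eq.1 hj with hj | rfl
      · exact ih h1 j hj
      · exact h2
  rw [walsh_eq_prod_range hk, walsh_eq_prod_range hk]
  refine Finset.prod_congr rfl fun j hj => ?_
  rw [rademacher, rademacher, hdigit n h j (Finset.mem_range.1 hj)]

theorem S2_congr {n : ℕ} (f : ℝ → ℝ) {x t : ℝ} (h : ⌊x * 2 ^ n⌋₊ = ⌊t * 2 ^ n⌋₊) :
    S2 n f x = S2 n f t :=
  Finset.sum_congr rfl fun _ hk => by rw [walsh_congr (Finset.mem_range.1 hk) h]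

theorem measurable_walsh (n : ℕ) : Measurable (walsh n) := by
  have hr : ∀ k, Measurable (rademacher k) := fun k =>
    (measurable_from_top (f := fun m : ℤ => (-1 : ℝ) ^ (m.toNat % 2))).comp
      (Int.measurable_floor.comp (measurable_id.mul_const _))
  unfold walsh
  refine Finset.measurable_fun_prod _ fun k _ => ?_
  split_ifs
  · exact hr k
  · exact measurable_const

theorem abs_walsh (n : ℕ) (x : ℝ) : |walsh n x| = 1 := by
  rw [walsh, Finset.abs_prod]
  refine Finset.prod_eq_one fun k _ => ?_
  split_ifs
  · rcases rademacher_eq_or k x with h | h <;> simp [h]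
  · simp

theorem measurable_S2 (n : ℕ) (f : ℝ → ℝ) : Measurable (S2 n f) :=
  Finset.measurable_fun_sum _ fun k _ => (measurable_walsh k).const_mul _

theorem exists_abs_sum_mul_walsh_le {ι : Type*} (s : Finset ι) (c : ι → ℝ) (e : ι → ℕ) :
    ∃ C, ∀ x, |∑ k ∈ s, c k * walsh (e k) x| ≤ C :=
  ⟨∑ k ∈ s, |c k|, fun x => (Finset.abs_sum_le_sum_abs _ _).trans_eq <| by
    simp [abs_mul, abs_walsh]⟩

theorem intervalIntegrable_mul_walsh {f : ℝ → ℝ} {a b : ℝ}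
    (hf : IntervalIntegrable f volume a b) (k : ℕ) :
    IntervalIntegrable (fun x => f x * walsh k x) volume a b := by
  rw [intervalIntegrable_iff] at hf ⊢
  exact hf.mul_bdd (c := 1) (measurable_walsh k).aestronglyMeasurable
    (Filter.Eventually.of_forall fun x => (abs_walsh k x).le)

/-- A point lies in the `m`-th (counting from zero) dyadic interval iff the floor is `m`. -/
theorem floor_mul_two_pow_eq_iff (n m : ℕ) {x : ℝ} (hx : 0 ≤ x) :
    ⌊x * 2 ^ n⌋₊ = m ↔ x ∈ Set.Ico ((m : ℝ) / 2 ^ n) ((m + 1 : ℝ) / 2 ^ n) := by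
  rw [Nat.floor_eq_iff (by positivity), Set.mem_Ico, div_le_iff₀ (by positivity),
    lt_div_iff₀ (by positivity)]

/-- The partial sum `S_{2^n} f` is the average of `f` over dyadic intervals. -/
theorem S2_eq_integral {n m : ℕ} (hm : m < 2 ^ n) {f : ℝ → ℝ}
    (hf : IntervalIntegrable f volume 0 1) :
    S2 n f ((m : ℝ) / 2 ^ n) =
      2 ^ n * ∫ t in ((m : ℝ) / 2 ^ n)..((m + 1 : ℝ) / 2 ^ n), f t := by
  have hx1 : (m : ℝ) / 2 ^ n < 1 := by
    rw [div_lt_one (by positivity)]; exact_mod_cast hm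
  have hb : (m + 1 : ℝ) / 2 ^ n ≤ 1 := by
    rw [div_le_one (by positivity)]; exact_mod_cast hm
  have hab : (m : ℝ) / 2 ^ n ≤ (m + 1 : ℝ) / 2 ^ n := by gcongr; linarith
  have hx : ⌊(m : ℝ) / 2 ^ n * 2 ^ n⌋₊ = m := by
    rw [div_mul_cancel₀ _ (by positivity), Nat.floor_natCast]
  have h0 : (0 : ℝ) ≤ (m : ℝ) / 2 ^ n := by positivity
  have hsub : Set.Ico ((m : ℝ) / 2 ^ n) ((m + 1 : ℝ) / 2 ^ n) ⊆ Set.Ico 0 1 :=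
    Set.Ico_subset_Ico h0 hb
  calc S2 n f ((m : ℝ) / 2 ^ n)
      = ∫ t in (0 : ℝ)..1, ∑ k ∈ Finset.range (2 ^ n),
          f t * walsh k t * walsh k ((m : ℝ) / 2 ^ n) := by
        rw [intervalIntegral.integral_finsetSum fun k _ =>
          (intervalIntegrable_mul_walsh hf k).mul_const _]
        simp [S2, fcoef]
    _ = ∫ t in Set.Ico (0 : ℝ) 1,
          (Set.Ico ((m : ℝ) / 2 ^ n) ((m + 1 : ℝ) / 2 ^ n)).indicator
            (fun t => 2 ^ n * f t) t := by
        rw [intervalIntegral.integral_of_le zero_le_one, ← integral_Ico_eq_integral_Ioc]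
        refine setIntegral_congr_fun measurableSet_Ico fun t ht => ?_
        have hsum := sum_walsh_mul_walsh n hx1 ht.2
        simp only [hx, eq_comm (a := m), floor_mul_two_pow_eq_iff n m ht.1] at hsum
        have : ∑ k ∈ Finset.range (2 ^ n), f t * walsh k t * walsh k ((m : ℝ) / 2 ^ n) =
            f t * ∑ k ∈ Finset.range (2 ^ n), walsh k ((m : ℝ) / 2 ^ n) * walsh k t := by
          rw [Finset.mul_sum]
          exact Finset.sum_congr rfl fun k _ => by ring
        simp only [this, hsum, Set.indicator_apply]
        split_ifs <;> ring
    _ = _ := by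
        rw [setIntegral_indicator measurableSet_Ico, Set.inter_eq_right.2 hsub,
          integral_Ico_eq_integral_Ioc, ← intervalIntegral.integral_of_le hab,
          intervalIntegral.integral_const_mul]

theorem S2_primitive {n m : ℕ} (hm : m < 2 ^ n) {g : ℝ → ℝ}
    (hg : ∀ a b, IntervalIntegrable g volume a b) {G ξ : ℝ}
    (hconst : ∀ t ∈ Set.Ico ((m : ℝ) / 2 ^ n) ((m + 1 : ℝ) / 2 ^ n), g t = G)
    (hξ : ξ ∈ Set.Ico ((m : ℝ) / 2 ^ n) ((m + 1 : ℝ) / 2 ^ n)) :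
    S2 n (fun s => ∫ t in ξ..s, g t) ((m : ℝ) / 2 ^ n) =
      G * ((2 * m + 1 : ℝ) / 2 ^ (n + 1) - ξ) := by
  have hab : (m : ℝ) / 2 ^ n ≤ (m + 1 : ℝ) / 2 ^ n := by gcongr; linarith
  rw [S2_eq_integral hm
    ((intervalIntegral.continuous_primitive hg ξ).intervalIntegrable 0 1)]
  have hprim : ∀ s ∈ Set.Ico ((m : ℝ) / 2 ^ n) ((m + 1 : ℝ) / 2 ^ n),
      ∫ t in ξ..s, g t = G * (s - ξ) := by
    intro s hs
    rw [intervalIntegral.integral_congr (g := fun _ => G) fun t ht =>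
      hconst t (Set.ordConnected_Ico.uIcc_subset hξ hs ht)]
    simp [mul_comm]
  rw [intervalIntegral.integral_of_le hab, ← integral_Ico_eq_integral_Ioc,
    setIntegral_congr_fun measurableSet_Ico hprim, integral_Ico_eq_integral_Ioc,
    ← intervalIntegral.integral_of_le hab, intervalIntegral.integral_const_mul,
    intervalIntegral.integral_sub (by simp) (by simp), integral_id,
    intervalIntegral.integral_const, smul_eq_mul]
  field_simp
  ring

/-- Case `k* = i` of the multistep algorithm: the value of the discretized solution on
the dyadic interval containing `ξ`. -/
theorem multistep_case_equal (p q : ℝ → ℝ)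
    (hpi : IntegrableOn p (Set.Ico (0:ℝ) 1)) (hqi : IntegrableOn q (Set.Ico (0:ℝ) 1))
    (ξ : ℝ) (hξ : ξ ∈ Set.Ico (0:ℝ) 1) (η : ℝ) (n : ℕ) (hn : 1 ≤ n)
    (kstar : ℕ) (hk1 : 1 ≤ kstar) (hk2 : kstar ≤ 2 ^ n)
    (hξ1 : ((kstar : ℝ) - 1) / 2 ^ n ≤ ξ) (hξ2 : ξ < (kstar : ℝ) / 2 ^ n)
    (ybar : ℝ → ℝ)
    (hpoly : ∃ c : Fin (2 ^ n) → ℝ, ∀ x : ℝ, ybar x = ∑ k : Fin (2 ^ n), c k * walsh k.1 x)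
    (heq : ∀ x ∈ Set.Ico (0:ℝ) 1,
      ybar x = η + S2 n (fun s => ∫ t in ξ..s, (S2 n q t - S2 n p t * ybar t)) x) :
    ybar (((kstar : ℝ) - 1) / 2 ^ n) *
        (1 + S2 n p (((kstar : ℝ) - 1) / 2 ^ n) *
          ((2 * (kstar : ℝ) - 1) / 2 ^ (n + 1) - ξ)) =
      η + S2 n q (((kstar : ℝ) - 1) / 2 ^ n) *
        ((2 * (kstar : ℝ) - 1) / 2 ^ (n + 1) - ξ) := by
  obtain ⟨m, rfl⟩ : ∃ m, kstar = m + 1 := ⟨kstar - 1, by omega⟩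
  obtain ⟨c, hc⟩ := hpoly
  have hm : m < 2 ^ n := hk2
  push_cast at hξ1 hξ2 ⊢
  rw [add_sub_cancel_right] at hξ1 ⊢
  have hmid : (2 * ((m : ℝ) + 1) - 1) = 2 * m + 1 := by ring
  rw [hmid]
  have ha0 : (0 : ℝ) ≤ (m : ℝ) / 2 ^ n := by positivity
  have hy : Measurable ybar := by
    rw [funext hc]
    exact Finset.measurable_fun_sum _ fun k _ => (measurable_walsh k).const_mul _
  have hg : ∀ a b, IntervalIntegrable (fun t => S2 n q t - S2 n p t * ybar t) volume a b := by
    intro a b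
    obtain ⟨Cq, hCq⟩ := exists_abs_sum_mul_walsh_le (Finset.range (2 ^ n)) (fcoef q) id
    obtain ⟨Cp, hCp⟩ := exists_abs_sum_mul_walsh_le (Finset.range (2 ^ n)) (fcoef p) id
    obtain ⟨Cy, hCy⟩ := exists_abs_sum_mul_walsh_le Finset.univ c Fin.val
    refine (intervalIntegrable_const (c := Cq + Cp * Cy)).mono_fun
      ((measurable_S2 n q).sub ((measurable_S2 n p).mul hy)).aestronglyMeasurable
      (Filter.Eventually.of_forall fun t => ?_)
    refine le_trans ?_ (le_abs_self _)
    refine (abs_sub _ _).trans (add_le_add (hCq t) ?_)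
    rw [abs_mul, hc]
    exact mul_le_mul (hCp t) (hCy t) (abs_nonneg _) ((abs_nonneg _).trans (hCp t))
  have hfloor : ⌊(m : ℝ) / 2 ^ n * 2 ^ n⌋₊ = m := by
    rw [div_mul_cancel₀ _ (by positivity), Nat.floor_natCast]
  have hconst : ∀ t ∈ Set.Ico ((m : ℝ) / 2 ^ n) ((m + 1 : ℝ) / 2 ^ n),
      S2 n q t - S2 n p t * ybar t = S2 n q ((m : ℝ) / 2 ^ n) -
        S2 n p ((m : ℝ) / 2 ^ n) * ybar ((m : ℝ) / 2 ^ n) := by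
    intro t ht
    have h := ((floor_mul_two_pow_eq_iff n m (ha0.trans ht.1)).2 ht).trans hfloor.symm
    have hyt : ybar t = ybar ((m : ℝ) / 2 ^ n) := by
      rw [hc, hc]
      exact Finset.sum_congr rfl fun k _ => by rw [walsh_congr k.2 h]
    rw [S2_congr q h, S2_congr p h, hyt]
  have hval := heq ((m : ℝ) / 2 ^ n)
    ⟨ha0, by rw [div_lt_one (by positivity)]; exact_mod_cast hm⟩
  rw [S2_primitive hm hg hconst ⟨hξ1, hξ2⟩] at hval
  linear_combination hval
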